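/- The sets of flat elements are stable under the vertex and face actions: for all n ≥ 1, if Holᵥ(d) = 1 then Holᵥ(α ▷ᵥ d) = 1 for every α ∈ G₊, and the map d ↦ α ▷ᵥ d sends the set {d ∈ Gⁿ : Holᵥ(d) = 1} onto itself; similarly, if Hol_f(d) = 1 then Hol_f(x ▷_f d) = 1 for every x ∈ G₋, and d ↦ x ▷_f d sends {d ∈ Gⁿ : Hol_f(d) = 1} onto itself. (An instance of Lemma 3.15 'Stability of K_L under vertex and face actions'.) -/

import Mathlib

/-- The partial vertex holonomy `cₖ(d) = π₋(d₁)⋯π₋(d_{k-1})`. -/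
def vertexPartial {G : Type*} [Group G] (πm : G → G) {n : ℕ}
    (d : Fin n → G) (k : Fin n) : G :=
  (((List.finRange n).filter (fun i => decide (i < k))).map (fun i => πm (d i))).prod

/-- The vertex action `(α ▷ᵥ d)ₖ = π₊(α·cₖ(d))·dₖ` of `G₊` on `Gⁿ`. -/
def vertexAct {G : Type*} [Group G] (πm πp : G → G) {n : ℕ}
    (α : G) (d : Fin n → G) : Fin n → G :=
  fun k => πp (α * vertexPartial πm d k) * d k

/-- The vertex holonomy `Holᵥ(d) = π₋(d₁)⋯π₋(dₙ)`. -/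
def vertexHol {G : Type*} [Group G] (πm : G → G) {n : ℕ} (d : Fin n → G) : G :=
  ((List.finRange n).map (fun i => πm (d i))).prod

/-- The partial face holonomy `hₖ(d) = π₊(d_{k-1})⋯π₊(d₁)`. -/
def facePartial {G : Type*} [Group G] (πp : G → G) {n : ℕ}
    (d : Fin n → G) (k : Fin n) : G :=
  ((((List.finRange n).filter (fun i => decide (i < k))).reverse).map
    (fun i => πp (d i))).prod

/-- The face action `(x ▷_f d)ₖ = dₖ·π₋(hₖ(d)·x⁻¹)` of `G₋` on `Gⁿ`. -/
def faceAct {G : Type*} [Group G] (πm πp : G → G) {n : ℕ}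
    (x : G) (d : Fin n → G) : Fin n → G :=
  fun k => d k * πm (facePartial πp d k * x⁻¹)

/-- The face holonomy `Hol_f(d) = π₊(dₙ)⋯π₊(d₁)`. -/
def faceHol {G : Type*} [Group G] (πp : G → G) {n : ℕ} (d : Fin n → G) : G :=
  (((List.finRange n).reverse).map (fun i => πp (d i))).prod

theorem List.finRange_filter_lt {n : ℕ} (k : Fin n) :
    (List.finRange n).filter (fun i => decide (i < k)) = (List.finRange n).take k := by
  induction n with
  | zero => exact k.elim0
  | succ n ih =>
    rw [List.finRange_succ]
    induction k using Fin.cases with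
    | zero => simp
    | succ k =>
      simp only [List.filter_cons, Fin.succ_pos, decide_true, if_true, List.filter_map,
        Function.comp_def, Fin.succ_lt_succ_iff, Fin.val_succ, List.take_succ_cons,
        ih k, List.map_take]

section Factorization

variable {G : Type*} [Group G]

theorem vertexPartial_eq_partialProd (πm : G → G) {n : ℕ} (d : Fin n → G) (k : Fin n) :
    vertexPartial πm d k = Fin.partialProd (fun i => πm (d i)) k.castSucc := by
  simp [vertexPartial, Fin.partialProd, List.finRange_filter_lt, List.ofFn_eq_map,
    List.map_take]

theorem vertexHol_eq_partialProd (πm : G → G) {n : ℕ} (d : Fin n → G) :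
    vertexHol πm d = Fin.partialProd (fun i => πm (d i)) (Fin.last n) := by
  simp [vertexHol, Fin.partialProd, List.ofFn_eq_map, List.take_of_length_le]

variable {Gm Gp : Subgroup G} {πm πp : G → G}

theorem proj_mul_eq (hc : Subgroup.IsComplement (Gm : Set G) (Gp : Set G))
    (hπm : ∀ g, πm g ∈ Gm) (hπp : ∀ g, πp g ∈ Gp) (hfact : ∀ g, g = πm g * πp g)
    {a b : G} (ha : a ∈ Gm) (hb : b ∈ Gp) : πm (a * b) = a ∧ πp (a * b) = b := by
  have h := @hc.1 (⟨πm (a * b), hπm _⟩, ⟨πp (a * b), hπp _⟩) (⟨a, ha⟩, ⟨b, hb⟩)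
    (hfact (a * b)).symm
  simpa using h

theorem partialProd_mem (hπm : ∀ g, πm g ∈ Gm) {n : ℕ} (d : Fin n → G) (j : Fin (n + 1)) :
    Fin.partialProd (fun i => πm (d i)) j ∈ Gm := by
  induction j using Fin.induction with
  | zero => simp [Gm.one_mem]
  | succ j ih => rw [Fin.partialProd_succ]; exact Gm.mul_mem ih (hπm _)

theorem partialProd_vertexAct (hc : Subgroup.IsComplement (Gm : Set G) (Gp : Set G))
    (hπm : ∀ g, πm g ∈ Gm) (hπp : ∀ g, πp g ∈ Gp) (hfact : ∀ g, g = πm g * πp g)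
    {n : ℕ} {α : G} (hα : α ∈ Gp) (d : Fin n → G) (j : Fin (n + 1)) :
    Fin.partialProd (fun i => πm (vertexAct πm πp α d i)) j =
      πm (α * Fin.partialProd (fun i => πm (d i)) j) := by
  induction j using Fin.induction with
  | zero =>
    have h := (proj_mul_eq hc hπm hπp hfact Gm.one_mem hα).1
    simpa using h.symm
  | succ j ih =>
    rw [Fin.partialProd_succ, Fin.partialProd_succ, ih, vertexAct,
      vertexPartial_eq_partialProd]
    set c := Fin.partialProd (fun i => πm (d i)) j.castSucc
    have hmul : πp (α * c) * d j = πm (πp (α * c) * πm (d j)) *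
        (πp (πp (α * c) * πm (d j)) * πp (d j)) := by
      rw [← mul_assoc, ← hfact, mul_assoc, ← hfact]
    have hmul' : α * (c * πm (d j)) = (πm (α * c) * πm (πp (α * c) * πm (d j))) *
        πp (πp (α * c) * πm (d j)) := by
      rw [mul_assoc, ← hfact, ← mul_assoc, ← mul_assoc, ← hfact]
    rw [hmul, hmul', (proj_mul_eq hc hπm hπp hfact (hπm _) (Gp.mul_mem (hπp _) (hπp _))).1,
      (proj_mul_eq hc hπm hπp hfact (Gm.mul_mem (hπm _) (hπm _)) (hπp _)).1]

theorem vertexAct_vertexAct (hc : Subgroup.IsComplement (Gm : Set G) (Gp : Set G))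
    (hπm : ∀ g, πm g ∈ Gm) (hπp : ∀ g, πp g ∈ Gp) (hfact : ∀ g, g = πm g * πp g)
    {n : ℕ} {α : G} (hα : α ∈ Gp) (β : G) (d : Fin n → G) :
    vertexAct πm πp β (vertexAct πm πp α d) = vertexAct πm πp (β * α) d := by
  funext k
  have hc' := partialProd_vertexAct hc hπm hπp hfact hα d k.castSucc
  rw [← vertexPartial_eq_partialProd, ← vertexPartial_eq_partialProd] at hc'
  rw [vertexAct, hc', vertexAct, vertexAct]
  set c := vertexPartial πm d k
  have hmul : β * α * c = πm (β * πm (α * c)) * (πp (β * πm (α * c)) * πp (α * c)) := by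
    rw [← mul_assoc, ← hfact, mul_assoc β (πm _), ← hfact, mul_assoc]
  rw [hmul, (proj_mul_eq hc hπm hπp hfact (hπm _) (Gp.mul_mem (hπp _) (hπp _))).2, mul_assoc]

theorem one_vertexAct (hc : Subgroup.IsComplement (Gm : Set G) (Gp : Set G))
    (hπm : ∀ g, πm g ∈ Gm) (hπp : ∀ g, πp g ∈ Gp) (hfact : ∀ g, g = πm g * πp g)
    {n : ℕ} (d : Fin n → G) : vertexAct πm πp 1 d = d := by
  funext k
  have h := (proj_mul_eq hc hπm hπp hfact (partialProd_mem hπm d k.castSucc) Gp.one_mem).2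
  rw [mul_one] at h
  rw [vertexAct, vertexPartial_eq_partialProd, one_mul, h, one_mul]

theorem vertexHol_vertexAct (hc : Subgroup.IsComplement (Gm : Set G) (Gp : Set G))
    (hπm : ∀ g, πm g ∈ Gm) (hπp : ∀ g, πp g ∈ Gp) (hfact : ∀ g, g = πm g * πp g)
    {n : ℕ} {α : G} (hα : α ∈ Gp) {d : Fin n → G} (hd : vertexHol πm d = 1) :
    vertexHol πm (vertexAct πm πp α d) = 1 := by
  rw [vertexHol_eq_partialProd] at hd ⊢
  rw [partialProd_vertexAct hc hπm hπp hfact hα, hd, mul_one]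
  simpa using (proj_mul_eq hc hπm hπp hfact Gm.one_mem hα).1

theorem vertexAct_image (hc : Subgroup.IsComplement (Gm : Set G) (Gp : Set G))
    (hπm : ∀ g, πm g ∈ Gm) (hπp : ∀ g, πp g ∈ Gp) (hfact : ∀ g, g = πm g * πp g)
    {n : ℕ} {α : G} (hα : α ∈ Gp) :
    vertexAct πm πp α '' {d : Fin n → G | vertexHol πm d = 1} =
      {d : Fin n → G | vertexHol πm d = 1} := by
  refine Set.Subset.antisymm ?_ fun d hd => ?_
  · rintro _ ⟨d, hd, rfl⟩
    exact vertexHol_vertexAct hc hπm hπp hfact hα hd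
  · refine ⟨vertexAct πm πp α⁻¹ d,
      vertexHol_vertexAct hc hπm hπp hfact (Gp.inv_mem hα) hd, ?_⟩
    rw [vertexAct_vertexAct hc hπm hπp hfact (Gp.inv_mem hα), mul_inv_cancel,
      one_vertexAct hc hπm hπp hfact]

/-- Inversion turns the face holonomy into the vertex holonomy for the factorization with the
two factors exchanged. -/
theorem faceHol_eq_inv_vertexHol (πp : G → G) {n : ℕ} (d : Fin n → G) :
    faceHol πp d = (vertexHol (fun g => (πp g⁻¹)⁻¹) d⁻¹)⁻¹ := by
  simp [faceHol, vertexHol, List.prod_inv_reverse, Function.comp_def]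

/-- Inversion turns the face action into the vertex action for the factorization with the
two factors exchanged. -/
theorem faceAct_eq_inv_vertexAct (πm πp : G → G) {n : ℕ} (x : G) (d : Fin n → G) :
    faceAct πm πp x d =
      (vertexAct (fun g => (πp g⁻¹)⁻¹) (fun g => (πm g⁻¹)⁻¹) x d⁻¹)⁻¹ := by
  funext k
  simp [faceAct, vertexAct, facePartial, vertexPartial, List.prod_inv_reverse,
    Function.comp_def]

end Factorization

/-- **Stability of the flat elements under vertex and face actions:**
if `Holᵥ(d) = 1` then `Holᵥ(α ▷ᵥ d) = 1` for every `α ∈ G₊`, and `d ↦ α ▷ᵥ d`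
maps `{d : Holᵥ(d) = 1}` onto itself; similarly, if `Hol_f(d) = 1` then
`Hol_f(x ▷_f d) = 1` for every `x ∈ G₋`, and `d ↦ x ▷_f d` maps
`{d : Hol_f(d) = 1}` onto itself. -/
theorem flat_elements_stable {G : Type*} [Group G] (Gm Gp : Subgroup G)
    (hc : Subgroup.IsComplement (Gm : Set G) (Gp : Set G))
    (πm πp : G → G)
    (hπm : ∀ g, πm g ∈ Gm) (hπp : ∀ g, πp g ∈ Gp)
    (hfact : ∀ g, g = πm g * πp g) :
    ∀ n : ℕ, 1 ≤ n →
      ((∀ α : G, α ∈ Gp → ∀ d : Fin n → G, vertexHol πm d = 1 →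
          vertexHol πm (vertexAct πm πp α d) = 1) ∧
        (∀ α : G, α ∈ Gp →
          vertexAct πm πp α '' {d : Fin n → G | vertexHol πm d = 1} =
            {d : Fin n → G | vertexHol πm d = 1})) ∧
      ((∀ x : G, x ∈ Gm → ∀ d : Fin n → G, faceHol πp d = 1 →
          faceHol πp (faceAct πm πp x d) = 1) ∧
        (∀ x : G, x ∈ Gm →
          faceAct πm πp x '' {d : Fin n → G | faceHol πp d = 1} =
            {d : Fin n → G | faceHol πp d = 1})) := by
  intro n _
  have hc' : Subgroup.IsComplement (Gp : Set G) (Gm : Set G) :=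
    Subgroup.IsComplement'.symm hc
  have hπm' : ∀ g, (πm g⁻¹)⁻¹ ∈ Gm := fun g => Gm.inv_mem (hπm _)
  have hπp' : ∀ g, (πp g⁻¹)⁻¹ ∈ Gp := fun g => Gp.inv_mem (hπp _)
  have hfact' : ∀ g, g = (πp g⁻¹)⁻¹ * (πm g⁻¹)⁻¹ := fun g => by
    rw [← mul_inv_rev, ← hfact, inv_inv]
  refine ⟨⟨fun α hα d hd => vertexHol_vertexAct hc hπm hπp hfact hα hd,
    fun α hα => vertexAct_image hc hπm hπp hfact hα⟩, fun x hx d hd => ?_, fun x hx => ?_⟩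
  · rw [faceHol_eq_inv_vertexHol, inv_eq_one] at hd ⊢
    rw [faceAct_eq_inv_vertexAct, inv_inv]
    exact vertexHol_vertexAct hc' hπp' hπm' hfact' hx hd
  · have himage := vertexAct_image (n := n) hc' hπp' hπm' hfact' hx
    have hflat : {d : Fin n → G | faceHol πp d = 1} =
        Inv.inv '' {d : Fin n → G | vertexHol (fun g => (πp g⁻¹)⁻¹) d = 1} := by
      ext d
      simp [faceHol_eq_inv_vertexHol]
    rw [hflat, Set.image_image]
    simp only [faceAct_eq_inv_vertexAct, inv_inv]
    rw [← Set.image_image Inv.inv, himage]
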